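/- Let m = m₁ + m₂ and let G″ be the graph obtained from G(L⁽¹⁾,x,y,l,m) by replacing the copies Lᵢ for i = m₁+1, …, m with copies of L⁽²⁾ (with their distinguished vertices x, y playing the roles of xᵢ, yᵢ). For all integers l ≥ 2, m ≥ 1 and m₂ ≥ l − 2, the toughness of G″ equals (l + 3m₂)/(2m₂ + 1). -/

import Mathlib

open SimpleGraph

/-- Number of connected components of the subgraph induced on the complement of `S`. -/
noncomputable def numComponents {V : Type} (G : SimpleGraph V) (S : Set V) : ℕ :=
  Nat.card (G.induce Sᶜ).ConnectedComponent

/-- `G` is `t`-tough: `|S| ≥ t · ω(G \ S)` for every vertex subset `S`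
with `ω(G \ S) > 1`. -/
def IsTough {V : Type} (t : ℝ) (G : SimpleGraph V) : Prop :=
  ∀ S : Finset V, 1 < numComponents G ↑S →
    t * (numComponents G ↑S : ℝ) ≤ (S.card : ℝ)

/-- The toughness of `G` equals `t`: `t` is the greatest nonnegative real
for which `G` is `t`-tough. -/
def HasToughness {V : Type} (G : SimpleGraph V) (t : ℝ) : Prop :=
  IsGreatest {s : ℝ | 0 ≤ s ∧ IsTough s G} t

/-- A Hamiltonian cycle: a cycle whose support contains every vertex. -/
def IsHamCycle {V : Type} {G : SimpleGraph V} {v : V} (p : G.Walk v v) : Prop :=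
  p.IsCycle ∧ ∀ u, u ∈ p.support

/-- A graph is Hamiltonian if it contains a Hamiltonian cycle. -/
def IsHam {V : Type} (G : SimpleGraph V) : Prop :=
  ∃ (v : V) (p : G.Walk v v), IsHamCycle p

/-- `x` and `y` are connected by a Hamilton path of `G`: a path with endpoints
`x` and `y` containing every vertex of `G`. -/
def HamConnected {V : Type} (G : SimpleGraph V) (x y : V) : Prop :=
  ∃ p : G.Walk x y, p.IsPath ∧ ∀ v, v ∈ p.support

/-- `L⁽¹⁾`: the 8-cycle `w₁w₂…w₈w₁` (here `wᵢ = i - 1`) together with the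
edges `w₂w₄, w₄w₆, w₆w₈, w₂w₈`; `x = w₁ = 0`, `y = w₅ = 4`. -/
def L1 : SimpleGraph (Fin 8) := SimpleGraph.fromEdgeSet
  {s(0,1), s(1,2), s(2,3), s(3,4), s(4,5), s(5,6), s(6,7), s(7,0),
   s(1,3), s(3,5), s(5,7), s(1,7)}

/-- `L⁽²⁾`: obtained from `L⁽¹⁾` by deleting `w₁w₂, w₂w₈` and identifying `w₂`
with `w₈`.  Vertices `w₁, w, w₃, w₄, w₅, w₆, w₇` are `0, 1, 2, 3, 4, 5, 6`;
`x = w₁ = 0`, `y = w₅ = 4`. -/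
def L2 : SimpleGraph (Fin 7) := SimpleGraph.fromEdgeSet
  {s(0,1), s(1,2), s(2,3), s(3,4), s(4,5), s(5,6), s(6,1),
   s(1,3), s(3,5), s(5,1)}

/-- `L⁽³⁾`: obtained from `L⁽¹⁾` by adding a new vertex `w₉ = 8` and the edges
`w₄w₉, w₆w₉`; `x = w₁ = 0`, `y = w₅ = 4`. -/
def L3 : SimpleGraph (Fin 9) := SimpleGraph.fromEdgeSet
  {s(0,1), s(1,2), s(2,3), s(3,4), s(4,5), s(5,6), s(6,7), s(7,0),
   s(1,3), s(3,5), s(5,7), s(1,7), s(3,8), s(5,8)}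

/-- `L⁽⁴⁾`: the triangle `w₁w₂w₃w₁` together with pendant vertices `w₄, w₅`
and edges `w₁w₄, w₃w₅` (here `wᵢ = i - 1`); `x = w₄ = 3`, `y = w₅ = 4`. -/
def L4 : SimpleGraph (Fin 5) := SimpleGraph.fromEdgeSet
  {s(0,1), s(1,2), s(2,0), s(0,3), s(2,4)}

/-- A building block: a graph together with two distinguished vertices. -/
structure Block where
  V : Type
  G : SimpleGraph V
  x : V
  y : V

/-- The graph `G(L,x,y,l,m)` (allowing a different block for each of the `m`
copies): disjoint copies `L₁, …, Lₘ` of the blocks, all possible edges between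
pairs of vertices in `{x₁, …, xₘ, y₁, …, yₘ}`, joined with a complete graph
`T = Kₗ`. -/
def GGen {m : ℕ} (l : ℕ) (B : Fin m → Block) :
    SimpleGraph (Fin l ⊕ Σ i, (B i).V) :=
  SimpleGraph.fromRel fun a b =>
    (∃ t, a = Sum.inl t) ∨ (∃ t, b = Sum.inl t) ∨
    (∃ (i : Fin m) (u v : (B i).V),
      a = Sum.inr ⟨i, u⟩ ∧ b = Sum.inr ⟨i, v⟩ ∧ (B i).G.Adj u v) ∨
    (∃ p q : Σ i, (B i).V, a = Sum.inr p ∧ b = Sum.inr q ∧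
      (p.2 = (B p.1).x ∨ p.2 = (B p.1).y) ∧ (q.2 = (B q.1).x ∨ q.2 = (B q.1).y))

def blockL1 : Block := ⟨Fin 8, L1, 0, 4⟩
def blockL2 : Block := ⟨Fin 7, L2, 0, 4⟩
def blockL3 : Block := ⟨Fin 9, L3, 0, 4⟩
def blockL4 : Block := ⟨Fin 5, L4, 3, 4⟩

theorem ncard_sum_sigma {α ι : Type} {β : ι → Type} [Finite α] [Fintype ι] [∀ i, Finite (β i)]
    (S : Set (α ⊕ Σ i, β i)) :
    S.ncard = {a | Sum.inl a ∈ S}.ncard + ∑ i, {v | Sum.inr ⟨i, v⟩ ∈ S}.ncard := by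
  have e : S ≃ {a | Sum.inl a ∈ S} ⊕ Σ i, {v : β i | Sum.inr ⟨i, v⟩ ∈ S} :=
    { toFun := fun p => match p with
        | ⟨.inl a, h⟩ => .inl ⟨a, h⟩
        | ⟨.inr ⟨i, v⟩, h⟩ => .inr ⟨i, v, h⟩
      invFun := fun p => match p with
        | .inl a => ⟨.inl a.1, a.2⟩
        | .inr ⟨i, v⟩ => ⟨.inr ⟨i, v.1⟩, v.2⟩
      left_inv := by rintro ⟨_ | _, _⟩ <;> rfl
      right_inv := by rintro (_ | _) <;> rfl }
  simp only [← Nat.card_coe_set_eq]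
  rw [Nat.card_congr e, Nat.card_sum, Nat.card_sigma]

/-- `φ` is constant along the edges of `G` outside `S`, and takes the value `κ` at those of the
vertices `x`, `y` that lie outside `S`. -/
structure IsLabelling {V K : Type} (G : SimpleGraph V) (x y : V) (S : Set V) (φ : V → K)
    (κ : K) : Prop where
  adj : ∀ u v, G.Adj u v → u ∉ S → v ∉ S → φ u = φ v
  left : x ∉ S → φ x = κ
  right : y ∉ S → φ y = κ

theorem ncard_image_diff_le_two {V K : Type} {S : Set V} {φ : V → K} {κ : K} (a b : K)
    (h : ∀ u, u ∉ S → φ u = κ ∨ φ u = a ∨ φ u = b) : (φ '' Sᶜ \ {κ}).ncard ≤ 2 := by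
  refine (Set.ncard_le_ncard (t := {a, b}) ?_).trans ((Set.ncard_insert_le _ _).trans (by simp))
  rintro _ ⟨⟨u, hu, rfl⟩, hκ⟩
  exact (h u hu).resolve_left hκ

theorem le_of_ncard_image_diff {V K : Type} {S : Set V} {φ : V → K} {κ : K} (k : ℕ)
    (h₁ : ∀ u, u ∉ S → φ u ≠ κ → 2 ≤ S.ncard)
    (h₂ : ∀ u v, u ∉ S → v ∉ S → φ u ≠ κ → φ v ≠ κ → φ u ≠ φ v → k ≤ S.ncard) :
    (1 ≤ (φ '' Sᶜ \ {κ}).ncard → 2 ≤ S.ncard) ∧ (2 ≤ (φ '' Sᶜ \ {κ}).ncard → k ≤ S.ncard) := by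
  constructor <;> intro h
  · obtain ⟨_, ⟨u, hu, rfl⟩, hκ⟩ := Set.nonempty_of_ncard_ne_zero (Nat.one_le_iff_ne_zero.mp h)
    exact h₁ u hu hκ
  · obtain ⟨_, ⟨⟨u, hu, rfl⟩, hκ⟩, _, ⟨⟨v, hv, rfl⟩, hκ'⟩, huv⟩ :=
      (Set.one_lt_ncard_iff_nontrivial_and_finite.mp h).1
    exact h₂ u v hu hv hκ hκ' huv

open Classical in
theorem ncard_eq_sum_ite {V : Type} [Fintype V] (S : Set V) :
    S.ncard = ∑ v, if v ∈ S then 1 else 0 := by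
  simp [Set.ncard_eq_toFinset_card']

open Classical in
theorem L1_two_mul_ncard_le {K : Type} {φ : Fin 8 → K} {κ : K} {S : Set (Fin 8)}
    (h : IsLabelling L1 0 4 S φ κ) : 2 * (φ '' Sᶜ \ {κ}).ncard ≤ S.ncard := by
  obtain ⟨h, h0, h4⟩ := h
  have e01 := h 0 1 (by simp [L1])
  have e12 := h 1 2 (by simp [L1])
  have e23 := h 2 3 (by simp [L1])
  have e34 := h 3 4 (by simp [L1])
  have e45 := h 4 5 (by simp [L1])
  have e56 := h 5 6 (by simp [L1])
  have e67 := h 6 7 (by simp [L1])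
  have e70 := h 7 0 (by simp [L1])
  have e13 := h 1 3 (by simp [L1])
  have e35 := h 3 5 (by simp [L1])
  have e57 := h 5 7 (by simp [L1])
  have e17 := h 1 7 (by simp [L1])
  clear h
  have hc := ncard_eq_sum_ite S
  rw [Fin.sum_univ_eight] at hc
  have c₀ : (φ '' Sᶜ \ {κ}).ncard ≤ 2 := by
    clear hc
    refine ncard_image_diff_le_two
      (if 1 ∉ S then φ 1 else if 2 ∉ S then φ 2 else φ 3)
      (if 5 ∉ S then φ 5 else if 6 ∉ S then φ 6 else φ 7) fun u => ?_
    fin_cases u <;> simp only [Fin.reduceFinMk, Fin.zero_eta, Fin.mk_one] <;> grind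
  obtain ⟨c₁, c₂⟩ := le_of_ncard_image_diff (S := S) (φ := φ) (κ := κ) 4
    (by
      rw [hc]; clear hc c₀
      intro u
      fin_cases u <;> simp only [Fin.reduceFinMk, Fin.zero_eta, Fin.mk_one] <;> grind)
    (by
      rw [hc]; clear hc c₀
      intro u v
      fin_cases u <;> fin_cases v <;>
        simp only [Fin.reduceFinMk, Fin.zero_eta, Fin.mk_one] <;> grind)
  omega

open Classical in
theorem L2_ncard_le {K : Type} {φ : Fin 7 → K} {κ : K} {S : Set (Fin 7)}
    (h : IsLabelling L2 0 4 S φ κ) :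
    (φ '' Sᶜ \ {κ}).ncard ≤ 2 ∧ 3 * (φ '' Sᶜ \ {κ}).ncard ≤ 2 * S.ncard ∧
      (0 ∈ S → 4 ∈ S → 2 * (φ '' Sᶜ \ {κ}).ncard ≤ S.ncard) := by
  obtain ⟨h, h0, h4⟩ := h
  have e01 := h 0 1 (by simp [L2])
  have e12 := h 1 2 (by simp [L2])
  have e23 := h 2 3 (by simp [L2])
  have e34 := h 3 4 (by simp [L2])
  have e45 := h 4 5 (by simp [L2])
  have e56 := h 5 6 (by simp [L2])
  have e61 := h 6 1 (by simp [L2])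
  have e13 := h 1 3 (by simp [L2])
  have e35 := h 3 5 (by simp [L2])
  have e51 := h 5 1 (by simp [L2])
  clear h
  have hc := ncard_eq_sum_ite S
  rw [Fin.sum_univ_seven] at hc
  have c₀ : (φ '' Sᶜ \ {κ}).ncard ≤ 2 := by
    clear hc
    refine ncard_image_diff_le_two
      (if 1 ∉ S then φ 1 else if 2 ∉ S then φ 2 else φ 3)
      (if 5 ∉ S then φ 5 else φ 6) fun u => ?_
    fin_cases u <;> simp only [Fin.reduceFinMk, Fin.zero_eta, Fin.mk_one] <;> grind
  obtain ⟨c₁, c₂⟩ := le_of_ncard_image_diff (S := S) (φ := φ) (κ := κ)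
    (if 0 ∈ S ∧ 4 ∈ S then 4 else 3)
    (by
      rw [hc]; clear hc c₀
      intro u
      fin_cases u <;> simp only [Fin.reduceFinMk, Fin.zero_eta, Fin.mk_one] <;> grind)
    (by
      rw [hc]; clear hc c₀
      intro u v
      fin_cases u <;> fin_cases v <;>
        simp only [Fin.reduceFinMk, Fin.zero_eta, Fin.mk_one] <;> grind)
  refine ⟨c₀, ?_, fun hx hy => ?_⟩
  · split_ifs at c₂ <;> omega
  · rw [if_pos ⟨hx, hy⟩] at c₂
    omega

section GGen

variable {l m : ℕ} {B : Fin m → Block}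

theorem GGen_adj_inl {t : Fin l} {a : Fin l ⊕ Σ i, (B i).V} (h : Sum.inl t ≠ a) :
    (GGen l B).Adj (Sum.inl t) a :=
  (fromRel_adj _ _ _).mpr ⟨h, .inl (.inl ⟨t, rfl⟩)⟩

theorem GGen_adj_of_adj {i : Fin m} {u v : (B i).V} (h : (B i).G.Adj u v) :
    (GGen l B).Adj (Sum.inr ⟨i, u⟩) (Sum.inr ⟨i, v⟩) :=
  (fromRel_adj _ _ _).mpr ⟨by simpa using h.ne, .inl (.inr (.inr (.inl ⟨i, u, v, rfl, rfl, h⟩)))⟩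

theorem GGen_adj_of_core {p q : Σ i, (B i).V} (hne : p ≠ q)
    (hp : p.2 = (B p.1).x ∨ p.2 = (B p.1).y) (hq : q.2 = (B q.1).x ∨ q.2 = (B q.1).y) :
    (GGen l B).Adj (Sum.inr p) (Sum.inr q) :=
  (fromRel_adj _ _ _).mpr ⟨by simpa using hne, .inl (.inr (.inr (.inr ⟨p, q, rfl, rfl, hp, hq⟩)))⟩

theorem GGen_adj_inr {p q : Σ i, (B i).V} (h : (GGen l B).Adj (Sum.inr p) (Sum.inr q)) :
    (∃ i u v, p = ⟨i, u⟩ ∧ q = ⟨i, v⟩ ∧ (B i).G.Adj u v) ∨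
      (p.2 = (B p.1).x ∨ p.2 = (B p.1).y) ∧ (q.2 = (B q.1).x ∨ q.2 = (B q.1).y) := by
  obtain ⟨-, h | h⟩ := (fromRel_adj _ _ _).mp h
  · obtain ⟨_, ⟨⟩⟩ | ⟨_, ⟨⟩⟩ | ⟨i, u, v, ⟨⟩, ⟨⟩, h'⟩ | ⟨_, _, ⟨⟩, ⟨⟩, hp, hq⟩ := h
    · exact .inl ⟨i, u, v, rfl, rfl, h'⟩
    · exact .inr ⟨hp, hq⟩
  · obtain ⟨_, ⟨⟩⟩ | ⟨_, ⟨⟩⟩ | ⟨i, u, v, ⟨⟩, ⟨⟩, h'⟩ | ⟨_, _, ⟨⟩, ⟨⟩, hp, hq⟩ := h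
    · exact .inl ⟨i, v, u, rfl, rfl, h'.symm⟩
    · exact .inr ⟨hq, hp⟩

theorem numComponents_GGen_le_one {S : Set (Fin l ⊕ Σ i, (B i).V)} {t : Fin l}
    (ht : Sum.inl t ∉ S) : numComponents (GGen l B) S ≤ 1 := by
  have key : ∀ a, ((GGen l B).induce Sᶜ).Reachable ⟨Sum.inl t, ht⟩ a := by
    intro a
    by_cases h : (⟨Sum.inl t, ht⟩ : ↥Sᶜ) = a
    · exact h ▸ Reachable.refl _
    · exact Adj.reachable (GGen_adj_inl fun e => h (Subtype.ext e))
  have : Subsingleton ((GGen l B).induce Sᶜ).ConnectedComponent :=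
    Preconnected.subsingleton_connectedComponent fun a b => (key a).symm.trans (key b)
  exact Finite.card_le_one_iff_subsingleton.mpr this

theorem exists_isLabelling_numComponents_le [∀ i, Finite (B i).V]
    {S : Set (Fin l ⊕ Σ i, (B i).V)} (hS : ∀ t, Sum.inl t ∈ S) :
    ∃ (K : Type) (φ : ∀ i, (B i).V → K) (κ : K),
      (∀ i, IsLabelling (B i).G (B i).x (B i).y {v | Sum.inr ⟨i, v⟩ ∈ S} (φ i) κ) ∧
      numComponents (GGen l B) S ≤
        1 + ∑ i, (φ i '' {v | Sum.inr ⟨i, v⟩ ∈ S}ᶜ \ {κ}).ncard ∧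
      ((∀ i, Sum.inr ⟨i, (B i).x⟩ ∈ S ∧ Sum.inr ⟨i, (B i).y⟩ ∈ S) →
        numComponents (GGen l B) S ≤
          ∑ i, (φ i '' {v | Sum.inr ⟨i, v⟩ ∈ S}ᶜ \ {κ}).ncard) := by
  classical
  let X := ((GGen l B).induce Sᶜ).ConnectedComponent
  let f : (Σ i, (B i).V) → Option X := fun p =>
    if h : Sum.inr p ∈ S then none else some (connectedComponentMk _ ⟨Sum.inr p, h⟩)
  have f_eq {p : Σ i, (B i).V} (h : Sum.inr p ∉ S) :
      f p = some (connectedComponentMk _ ⟨Sum.inr p, h⟩) := dif_neg h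
  have f_adj {p q : Σ i, (B i).V} (h : (GGen l B).Adj (Sum.inr p) (Sum.inr q))
      (hp : Sum.inr p ∉ S) (hq : Sum.inr q ∉ S) : f p = f q := by
    rw [f_eq hp, f_eq hq]
    exact congrArg some (ConnectedComponent.sound (Adj.reachable h))
  have core : ∃ κ : Option X,
      (∀ p : Σ i, (B i).V, (p.2 = (B p.1).x ∨ p.2 = (B p.1).y) → Sum.inr p ∉ S → f p = κ) ∧
      ((∀ i, Sum.inr ⟨i, (B i).x⟩ ∈ S ∧ Sum.inr ⟨i, (B i).y⟩ ∈ S) → κ = none) := by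
    by_cases h : ∃ p : Σ i, (B i).V, (p.2 = (B p.1).x ∨ p.2 = (B p.1).y) ∧ Sum.inr p ∉ S
    · obtain ⟨p, hp, hpS⟩ := h
      refine ⟨f p, fun q hq hqS => ?_, fun H => ?_⟩
      · by_cases hne : q = p
        · rw [hne]
        · exact f_adj (GGen_adj_of_core hne hq hp) hqS hpS
      · obtain ⟨i, v⟩ := p
        obtain hv | hv := hp <;> dsimp only at hv <;> subst hv
        exacts [absurd (H i).1 hpS, absurd (H i).2 hpS]
    · exact ⟨none, fun p hp hpS => absurd ⟨p, hp, hpS⟩ h, fun _ => rfl⟩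
  obtain ⟨κ, hκ, hnone⟩ := core
  let C : Fin m → Set (Option X) :=
    fun i => (fun v => f ⟨i, v⟩) '' {v | Sum.inr ⟨i, v⟩ ∈ S}ᶜ \ {κ}
  have hcard : numComponents (GGen l B) S = (Set.range (some : X → Option X)).ncard := by
    rw [← Set.image_univ, Set.ncard_image_of_injective _ (Option.some_injective _), Set.ncard_univ]
    rfl
  have hcover : Set.range (some : X → Option X) \ {κ} ⊆ ⋃ i, C i := by
    rintro _ ⟨⟨c, rfl⟩, hc⟩
    induction c using ConnectedComponent.ind with | _ a
    obtain ⟨t | ⟨i, v⟩, ha⟩ := a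
    · exact absurd (hS t) ha
    · exact Set.mem_iUnion.mpr ⟨i, ⟨v, ha, f_eq ha⟩, hc⟩
  have hle := (Set.ncard_le_ncard hcover).trans (Set.ncard_iUnion_le_of_fintype C)
  refine ⟨Option X, fun i v => f ⟨i, v⟩, κ,
    fun i => ⟨fun u v h hu hv => f_adj (GGen_adj_of_adj h) hu hv, hκ ⟨i, _⟩ (.inl rfl),
      hκ ⟨i, _⟩ (.inr rfl)⟩, ?_, fun H => ?_⟩
  · have := Set.ncard_le_ncard_sdiff_add_ncard (Set.range (some : X → Option X)) {κ}
    rw [Set.ncard_singleton] at this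
    change _ ≤ 1 + ∑ i, (C i).ncard
    omega
  · rw [hnone H, Set.sdiff_singleton_eq_self (by simp)] at hle
    exact hcard.trans_le hle

/-- Deleting some `s` vertices other than `x` from the block separates `k` components from each
other and from `x` and `y`. -/
def HasCut (B : Block) (k s : ℕ) : Prop :=
  ∃ (C : Set B.V) (χ : B.V → Option (Fin k)), C.ncard = s ∧ B.x ∉ C ∧
    IsLabelling B.G B.x B.y C χ none ∧ ∀ j, ∃ v, v ∉ C ∧ χ v = some j

theorem exists_card_eq_le_numComponents [∀ i, Finite (B i).V] (hm : 0 < m) (k s : Fin m → ℕ)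
    (h : ∀ i, HasCut (B i) (k i) (s i)) :
    ∃ S : Finset (Fin l ⊕ Σ i, (B i).V), S.card = l + ∑ i, s i ∧
      1 + ∑ i, k i ≤ numComponents (GGen l B) ↑S := by
  choose C χ hC hx hχ hsurj using h
  let S : Set (Fin l ⊕ Σ i, (B i).V) := {a | ∀ p, a = Sum.inr p → p.2 ∈ C p.1}
  have hSl (t : Fin l) : Sum.inl t ∈ S := by simp [S]
  have hSr (i : Fin m) (v : (B i).V) : Sum.inr ⟨i, v⟩ ∈ S ↔ v ∈ C i := by
    simp only [S, Set.mem_ofPred_eq, Sum.inr.injEq]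
    exact ⟨fun h => h _ rfl, by rintro h _ rfl; exact h⟩
  refine ⟨(Set.toFinite S).toFinset, ?_, ?_⟩
  · rw [← Set.ncard_eq_toFinset_card, ncard_sum_sigma]
    simp [hSl, hSr, hC]
  rw [Set.Finite.coe_toFinset]
  let g : ↥Sᶜ → Option (Σ i, Fin (k i)) := fun a => match a.1 with
    | .inl _ => none
    | .inr ⟨i, v⟩ => (χ i v).map (Sigma.mk i)
  have g_core (p : Σ i, (B i).V) (hp : p.2 = (B p.1).x ∨ p.2 = (B p.1).y)
      (hpS : Sum.inr p ∉ S) : g ⟨Sum.inr p, hpS⟩ = none := by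
    obtain ⟨i, v⟩ := p
    rw [hSr] at hpS
    obtain hv | hv := hp <;> dsimp only at hv <;> subst hv
    · simp [g, (hχ i).left hpS]
    · simp [g, (hχ i).right hpS]
  have g_adj (a b : ↥Sᶜ) (hab : ((GGen l B).induce Sᶜ).Adj a b) : g a = g b := by
    obtain ⟨a, ha⟩ := a
    obtain ⟨b, hb⟩ := b
    obtain t | p := a
    · exact absurd (hSl t) ha
    obtain t | q := b
    · exact absurd (hSl t) hb
    obtain ⟨i, u, v, rfl, rfl, huv⟩ | ⟨hp, hq⟩ := GGen_adj_inr hab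
    · simp [g, (hχ i).adj u v huv (by simpa [hSr] using ha) (by simpa [hSr] using hb)]
    · rw [g_core p hp ha, g_core q hq hb]
  let F : ((GGen l B).induce Sᶜ).ConnectedComponent → Option (Σ i, Fin (k i)) :=
    ConnectedComponent.lift g fun a b w _ => by
      induction w with
      | nil => rfl
      | cons h _ ih => exact (g_adj _ _ h).trans (ih (by simp_all))
  have F_surj : Function.Surjective F := by
    rintro (_ | ⟨i, j⟩)
    · exact ⟨connectedComponentMk _ ⟨Sum.inr ⟨⟨0, hm⟩, (B _).x⟩, by simp [hSr, hx]⟩,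
        g_core ⟨⟨0, hm⟩, (B _).x⟩ (.inl rfl) (by simp [hSr, hx])⟩
    · obtain ⟨v, hv, hj⟩ := hsurj i j
      have hvS : Sum.inr ⟨i, v⟩ ∉ S := by rwa [hSr]
      have hg : g ⟨Sum.inr ⟨i, v⟩, hvS⟩ = some ⟨i, j⟩ := by simp [g, hj]
      exact ⟨connectedComponentMk _ ⟨Sum.inr ⟨i, v⟩, hvS⟩, hg⟩
  have := Nat.card_le_card_of_surjective F F_surj
  rw [Finite.card_option, Nat.card_sigma] at this
  simp only [Nat.card_eq_fintype_card, Fintype.card_fin] at this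
  exact (Nat.add_comm _ _).trans_le this

/-- Bounds on the number of components not meeting `{x, y}` that arise by deleting a vertex set `S`
from the block: at most `|S| / 2` of them if `p` holds, or if `x` and `y` are both deleted, and
otherwise at most `2` and at most `2|S| / 3`. -/
def BlockBounds (B : Block) (p : Prop) : Prop :=
  ∀ (K : Type) (S : Set B.V) (φ : B.V → K) (κ : K), IsLabelling B.G B.x B.y S φ κ →
    (p → 2 * (φ '' Sᶜ \ {κ}).ncard ≤ S.ncard) ∧
      (¬p → (φ '' Sᶜ \ {κ}).ncard ≤ 2 ∧ 3 * (φ '' Sᶜ \ {κ}).ncard ≤ 2 * S.ncard) ∧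
      (B.x ∈ S → B.y ∈ S → 2 * (φ '' Sᶜ \ {κ}).ncard ≤ S.ncard)

theorem GGen_mul_numComponents_le [∀ i, Finite (B i).V] {p : Fin m → Prop} [DecidablePred p]
    {t : ℝ} (ht₁ : 3 / 2 ≤ t) (ht₂ : t ≤ 2) (hB : ∀ i, BlockBounds (B i) (p i))
    (hl : t ≤ l + ∑ i, if p i then 0 else 3 - 2 * t) {S : Finset (Fin l ⊕ Σ i, (B i).V)}
    (hS : 1 < numComponents (GGen l B) ↑S) :
    t * numComponents (GGen l B) ↑S ≤ S.card := by
  have hT : ∀ t, Sum.inl t ∈ (S : Set (Fin l ⊕ Σ i, (B i).V)) := fun t => by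
    by_contra h
    exact absurd (numComponents_GGen_le_one h) hS.not_ge
  obtain ⟨K, φ, κ, hφ, hle, hle'⟩ := exists_isLabelling_numComponents_le hT
  have hcard := ncard_sum_sigma (S : Set (Fin l ⊕ Σ i, (B i).V))
  simp only [hT, Set.ofPred_true, Set.ncard_univ, Nat.card_eq_fintype_card, Fintype.card_fin,
    Set.ncard_coe_finset] at hcard
  have hb := fun i => hB i _ _ _ _ (hφ i)
  obtain ⟨c, hc⟩ : ∃ c : Fin m → ℕ, ∀ i, (φ i '' {v : (B i).V |
      Sum.inr ⟨i, v⟩ ∈ (S : Set (Fin l ⊕ Σ i, (B i).V))}ᶜ \ {κ}).ncard = c i := ⟨_, fun _ => rfl⟩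
  obtain ⟨s, hs⟩ : ∃ s : Fin m → ℕ, ∀ i, {v : (B i).V |
      Sum.inr ⟨i, v⟩ ∈ (S : Set (Fin l ⊕ Σ i, (B i).V))}.ncard = s i := ⟨_, fun _ => rfl⟩
  simp only [hc, hs] at hb hcard hle hle'
  rw [hcard]
  by_cases H : ∀ i, Sum.inr ⟨i, (B i).x⟩ ∈ (S : Set (Fin l ⊕ Σ i, (B i).V)) ∧
      Sum.inr ⟨i, (B i).y⟩ ∈ (S : Set (Fin l ⊕ Σ i, (B i).V))
  · have h₁ := hle' H
    have h₂ : ∑ i, 2 * c i ≤ ∑ i, s i :=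
      Finset.sum_le_sum fun i _ => (hb i).2.2 (H i).1 (H i).2
    rw [← Finset.mul_sum] at h₂
    have h₃ : (2 * numComponents (GGen l B) ↑S : ℝ) ≤ (l + ∑ i, s i : ℕ) := by
      exact_mod_cast (by omega)
    refine le_trans ?_ h₃
    gcongr
  · have h₁ : ∑ i, (if p i then 0 else 3 - 2 * t) ≤
        ∑ i, ((s i : ℝ) - t * c i) := by
      refine Finset.sum_le_sum fun i _ => ?_
      split_ifs with hi
      · have : (2 * c i : ℝ) ≤ s i := by exact_mod_cast (hb i).1 hi
        nlinarith [(c i).cast_nonneg (α := ℝ)]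
      · have h₂ : (c i : ℝ) ≤ 2 := by exact_mod_cast ((hb i).2.1 hi).1
        have h₃ : (3 * c i : ℝ) ≤ 2 * s i := by exact_mod_cast ((hb i).2.1 hi).2
        nlinarith
    rw [Finset.sum_sub_distrib, ← Finset.mul_sum] at h₁
    have h₂ : (numComponents (GGen l B) ↑S : ℝ) ≤ 1 + ∑ i, (c i : ℝ) := by exact_mod_cast hle
    have h₃ := mul_le_mul_of_nonneg_left h₂ (by linarith : 0 ≤ t)
    push_cast
    linarith

end GGen

theorem hasCut_blockL1 : HasCut blockL1 2 4 := by
  change ∃ (C : Set (Fin 8)) (χ : Fin 8 → Option (Fin 2)), C.ncard = 4 ∧ 0 ∉ C ∧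
    IsLabelling L1 0 4 C χ none ∧ ∀ j, ∃ v, v ∉ C ∧ χ v = some j
  refine ⟨↑({1, 3, 5, 7} : Finset (Fin 8)),
    fun v => if v = 2 then some 0 else if v = 6 then some 1 else none,
    by rw [Set.ncard_coe_finset]; rfl, by decide, ⟨?_, by decide, by decide⟩, ?_⟩
  · simp only [L1, fromEdgeSet_adj, Finset.mem_coe, Set.mem_insert_iff, Set.mem_singleton_iff]
    decide
  · simp only [Finset.mem_coe]
    decide

theorem hasCut_blockL2 : HasCut blockL2 2 3 := by
  change ∃ (C : Set (Fin 7)) (χ : Fin 7 → Option (Fin 2)), C.ncard = 3 ∧ 0 ∉ C ∧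
    IsLabelling L2 0 4 C χ none ∧ ∀ j, ∃ v, v ∉ C ∧ χ v = some j
  refine ⟨↑({1, 3, 5} : Finset (Fin 7)),
    fun v => if v = 2 then some 0 else if v = 6 then some 1 else none,
    by rw [Set.ncard_coe_finset]; rfl, by decide, ⟨?_, by decide, by decide⟩, ?_⟩
  · simp only [L2, fromEdgeSet_adj, Finset.mem_coe, Set.mem_insert_iff, Set.mem_singleton_iff]
    decide
  · simp only [Finset.mem_coe]
    decide

theorem hasCut_zero (B : Block) : HasCut B 0 0 :=
  ⟨∅, fun _ => none, by simp, by simp, ⟨by simp, by simp, by simp⟩, finZeroElim⟩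

theorem blockBounds_ite (p : Prop) [d : Decidable p] :
    BlockBounds (if p then blockL1 else blockL2) p := by
  intro K S φ κ h
  obtain hp | hp := d
  · obtain ⟨h₁, h₂, h₃⟩ := L2_ncard_le h
    exact ⟨fun h' => absurd h' hp, fun _ => ⟨h₁, h₂⟩, h₃⟩
  · exact ⟨fun _ => L1_two_mul_ncard_le h, fun h' => absurd hp h', fun _ _ => L1_two_mul_ncard_le h⟩

theorem sum_ite_lt_add {M : Type} [AddCommMonoid M] (m₁ m₂ : ℕ) (a b : M) :
    ∑ i : Fin (m₁ + m₂), (if (i : ℕ) < m₁ then a else b) = m₁ • a + m₂ • b := by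
  simp [Fin.sum_univ_add]

theorem toughness_GGen_L1_L2 (l m₁ m₂ : ℕ) (hl : 2 ≤ l) (hm : 1 ≤ m₁ + m₂)
    (hm₂ : l ≤ m₂ + 2) :
    HasToughness
      (GGen l (fun i : Fin (m₁ + m₂) => if (i : ℕ) < m₁ then blockL1 else blockL2))
      (((l : ℝ) + 3 * m₂) / (2 * m₂ + 1)) := by
  have hfin : ∀ i : Fin (m₁ + m₂), Finite (if (i : ℕ) < m₁ then blockL1 else blockL2).V := by
    intro i
    split_ifs
    exacts [inferInstanceAs (Finite (Fin 8)), inferInstanceAs (Finite (Fin 7))]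
  have hl' : (2 : ℝ) ≤ l := by exact_mod_cast hl
  have hm₂' : (l : ℝ) ≤ m₂ + 2 := by exact_mod_cast hm₂
  have hpos : (0 : ℝ) < 2 * m₂ + 1 := by positivity
  refine ⟨⟨by positivity, fun S hS => ?_⟩, fun r ⟨_, hr⟩ => ?_⟩
  · obtain ⟨t, ht⟩ : ∃ t, t = ((l : ℝ) + 3 * m₂) / (2 * m₂ + 1) := ⟨_, rfl⟩
    have ht' : t * (2 * m₂ + 1) = l + 3 * m₂ := by rw [ht]; field_simp
    have ht₂ : t ≤ 2 := by rw [ht, div_le_iff₀ hpos]; linarith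
    have ht₁ : 3 / 2 ≤ t := by rw [ht, le_div_iff₀ hpos]; linarith
    rw [← ht]
    refine GGen_mul_numComponents_le (p := fun i => (i : ℕ) < m₁) ht₁ ht₂
      (fun i => blockBounds_ite _) ?_ hS
    simp only [sum_ite_lt_add, nsmul_eq_mul]
    linarith
  · have of_cut (k s : Fin (m₁ + m₂) → ℕ) (S : Finset _) (hk : 1 ≤ ∑ i, k i)
        (hcard : S.card = l + ∑ i, s i)
        (hω : 1 + ∑ i, k i ≤ numComponents (GGen l fun i : Fin (m₁ + m₂) =>
          if (i : ℕ) < m₁ then blockL1 else blockL2) ↑S) :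
        r * (1 + ∑ i, k i : ℕ) ≤ (l + ∑ i, s i : ℕ) :=
      hcard ▸ le_trans (by gcongr) (hr S (by omega))
    rw [le_div_iff₀ hpos]
    obtain rfl | hm₀ := Nat.eq_zero_or_pos m₂
    · obtain rfl : l = 2 := by omega
      obtain ⟨S, hcard, hω⟩ := exists_card_eq_le_numComponents (l := 2) hm (fun _ => 2)
        (fun i => if (i : ℕ) < m₁ then 4 else 3)
        (B := fun i : Fin (m₁ + 0) => if (i : ℕ) < m₁ then blockL1 else blockL2) fun i => by
          split_ifs
          exacts [hasCut_blockL1, hasCut_blockL2]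
      have h := of_cut _ _ S (by simp; omega) hcard hω
      simp only [sum_ite_lt_add] at h
      simp at h ⊢
      have : (0 : ℝ) ≤ m₁ := m₁.cast_nonneg
      nlinarith
    · obtain ⟨S, hcard, hω⟩ := exists_card_eq_le_numComponents (l := l) hm
        (fun i : Fin (m₁ + m₂) => if (i : ℕ) < m₁ then 0 else 2)
        (fun i => if (i : ℕ) < m₁ then 0 else 3)
        (B := fun i : Fin (m₁ + m₂) => if (i : ℕ) < m₁ then blockL1 else blockL2) fun i => by
          split_ifs
          exacts [hasCut_zero _, hasCut_blockL2]
      have h := of_cut _ _ S (by rw [sum_ite_lt_add]; simp; omega) hcard hω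
      simp only [sum_ite_lt_add] at h
      push_cast at h
      simp at h
      linarith
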